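/- For Im τ > 0, η(-1/τ) = (-iτ)^{1/2} η(τ), where the square root is the principal branch. -/

import Mathlib

open Complex Real

noncomputable def dedekindEta (τ : ℂ) : ℂ :=
  Complex.exp (π * I * τ / 12) * ∏' n : ℕ, (1 - Complex.exp (2 * π * I * (n + 1) * τ))

lemma dedekindEta_eq_eta (τ : ℂ) : dedekindEta τ = ModularForm.eta τ := by
  unfold dedekindEta ModularForm.eta
  simp_rw [ModularForm.eta_q_eq_cexp]
  congr 1
  simp only [Function.Periodic.qParam]
  push_cast
  congr 1
  ring

lemma cpow_half_aux (τ : ℂ) (hτ : 0 < τ.im) :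
    (-I * τ) ^ (1 / 2 : ℂ) = (I ^ (1 / 2 : ℂ))⁻¹ * τ ^ (1 / 2 : ℂ) := by
  have h0 : τ ≠ 0 := by rintro rfl; simp at hτ
  have hw : -I * τ ≠ 0 := mul_ne_zero (by simp) h0
  have hre : 0 < (-I * τ).re := by simpa using hτ
  have hτw : τ = I * (-I * τ) := by
    rw [← mul_assoc]; simp
  have harg : |(-I * τ).arg| < π / 2 := Complex.abs_arg_lt_pi_div_two_iff.mpr (Or.inl hre)
  rw [abs_lt] at harg
  have hlog : Complex.log (I * (-I * τ)) = Complex.log I + Complex.log (-I * τ) := by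
    rw [Complex.log_mul_eq_add_log_iff I_ne_zero hw, Complex.arg_I]
    constructor <;> linarith [harg.1, harg.2, Real.pi_pos]
  have key : τ ^ (1 / 2 : ℂ) = I ^ (1 / 2 : ℂ) * (-I * τ) ^ (1 / 2 : ℂ) := by
    rw [← hτw] at hlog
    rw [Complex.cpow_def_of_ne_zero h0, Complex.cpow_def_of_ne_zero I_ne_zero,
      Complex.cpow_def_of_ne_zero hw, ← Complex.exp_add, hlog, add_mul]
  have hI : (I : ℂ) ^ (1 / 2 : ℂ) ≠ 0 := by simp [Complex.cpow_eq_zero_iff]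
  rw [key, inv_mul_cancel_left₀ hI]

theorem eta_S_transform (τ : ℂ) (hτ : 0 < τ.im) :
    dedekindEta (-1 / τ) = (-I * τ) ^ (1 / 2 : ℂ) * dedekindEta τ := by
  have h := ModularForm.eta_comp_eq_csqrt_I_inv (show τ ∈ UpperHalfPlane.upperHalfPlaneSet from hτ)
  rw [dedekindEta_eq_eta, dedekindEta_eq_eta, cpow_half_aux τ hτ, mul_assoc]
  simpa [Complex.sqrt] using h
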